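/- arXiv:2404.05739 — 6 statements merged into one kernel-verified Lean document; each statement's English description precedes it below -/
import Mathlib

section
/- Let A₂₂ be a real m×m matrix, A₁₂ a real p×m matrix, L a real m×p matrix, F a real m×k matrix, and G a real k×p matrix. If the (m+k)×(m+k) real block matrix Ω = [[A₂₂ − L·A₁₂, F], [−G·A₁₂, 0]] is Hurwitz stable, then rank(G) = k and k ≤ rank(A₁₂). -/
/-- A real square matrix is Hurwitz stable if every root of its characteristic
polynomial over `ℂ` has strictly negative real part. -/
def IsHurwitz {n : Type*} [Fintype n] [DecidableEq n] (A : Matrix n n ℝ) : Prop :=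
  ∀ z : ℂ, (Matrix.charpoly (A.map Complex.ofReal)).IsRoot z → z.re < 0

/-- Paper's Theorem 1: if the block matrix `[[A₂₂ − L·A₁₂, F], [−G·A₁₂, 0]]`
is Hurwitz stable, then `rank G = k` and `k ≤ rank A₁₂`. -/
theorem rank_G_and_le_rank_A12_of_hurwitz {m p k : ℕ}
    (A₂₂ : Matrix (Fin m) (Fin m) ℝ) (A₁₂ : Matrix (Fin p) (Fin m) ℝ)
    (L : Matrix (Fin m) (Fin p) ℝ) (F : Matrix (Fin m) (Fin k) ℝ)
    (G : Matrix (Fin k) (Fin p) ℝ)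
    (hΩ : IsHurwitz (Matrix.fromBlocks (A₂₂ - L * A₁₂) F (-(G * A₁₂)) 0)) :
    G.rank = k ∧ k ≤ A₁₂.rank := by
  have hdet : (Matrix.fromBlocks (A₂₂ - L * A₁₂) F (-(G * A₁₂)) 0).det ≠ 0 := by
    intro h
    have h0 := hΩ 0 (by
      rw [Polynomial.IsRoot.def, Matrix.eval_charpoly, map_zero, zero_sub, Matrix.det_neg]
      have h1 := RingHom.map_det Complex.ofRealHom
        (Matrix.fromBlocks (A₂₂ - L * A₁₂) F (-(G * A₁₂)) 0)
      rw [h, map_zero] at h1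
      have h2 : ((Matrix.fromBlocks (A₂₂ - L * A₁₂) F (-(G * A₁₂)) 0).map
        Complex.ofReal).det = 0 := h1.symm
      rw [h2, mul_zero])
    simp at h0
  obtain ⟨X, hX⟩ : ∃ X, Matrix.fromBlocks (A₂₂ - L * A₁₂) F (-(G * A₁₂)) 0 * X = 1 :=
    ⟨_, Matrix.mul_nonsing_inv _ (isUnit_iff_ne_zero.mpr hdet)⟩
  rw [← Matrix.fromBlocks_toBlocks X, Matrix.fromBlocks_multiply, ← Matrix.fromBlocks_one,
    Matrix.fromBlocks_inj] at hX
  have h4 : G * (A₁₂ * (-X.toBlocks₁₂)) = 1 := by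
    have := hX.2.2.2
    rw [← this]
    simp [Matrix.mul_assoc]
  have hr : (G * (A₁₂ * (-X.toBlocks₁₂))).rank = k := by
    rw [h4, Matrix.rank_one, Fintype.card_fin]
  have hG : G.rank ≤ k := by simpa using Matrix.rank_le_card_height G
  refine ⟨le_antisymm hG ?_, ?_⟩
  · calc k = _ := hr.symm
      _ ≤ G.rank := Matrix.rank_mul_le_left _ _
  · calc k = _ := hr.symm
      _ ≤ (A₁₂ * (-X.toBlocks₁₂)).rank := Matrix.rank_mul_le_right _ _
      _ ≤ A₁₂.rank := Matrix.rank_mul_le_left _ _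
end

section
/- Let A₂₂ be a real m×m matrix, A₁₂ a real p×m matrix, L a real m×p matrix, F a real m×k matrix, and G a real k×p matrix. If the (m+k)×(m+k) real block matrix Ω = [[A₂₂ − L·A₁₂, F], [−G·A₁₂, 0]] is Hurwitz stable, then the k×m real matrix G·A₁₂ has rank k. -/
/-- Claim (39) in the proof of Theorem 1: if the block matrix
`[[A₂₂ − L·A₁₂, F], [−G·A₁₂, 0]]` is Hurwitz stable, then `rank (G·A₁₂) = k`. -/
theorem rank_GA12_of_hurwitz {m p k : ℕ}
    (A₂₂ : Matrix (Fin m) (Fin m) ℝ) (A₁₂ : Matrix (Fin p) (Fin m) ℝ)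
    (L : Matrix (Fin m) (Fin p) ℝ) (F : Matrix (Fin m) (Fin k) ℝ)
    (G : Matrix (Fin k) (Fin p) ℝ)
    (hΩ : IsHurwitz (Matrix.fromBlocks (A₂₂ - L * A₁₂) F (-(G * A₁₂)) 0)) :
    (G * A₁₂).rank = k := by
  set B := G * A₁₂ with hB
  set M := Matrix.fromBlocks (A₂₂ - L * A₁₂) F (-B) 0 with hM
  have hdet : M.det ≠ 0 := by
    intro h0
    have h := hΩ 0 (by
      have h1 : (M.map Complex.ofReal).det = 0 := by
        have := RingHom.map_det Complex.ofRealHom M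
        rw [h0, map_zero] at this
        exact this.symm
      rw [Polynomial.IsRoot.def, Matrix.eval_charpoly]
      simp [Matrix.det_neg, h1])
    simp at h
  have hinj : Function.Injective (fun v => Matrix.vecMul v B) := by
    intro v w hvw
    have hz : Matrix.vecMul (v - w) B = 0 := by
      rw [Matrix.sub_vecMul, sub_eq_zero]
      exact hvw
    have h2 : Matrix.vecMul (Sum.elim 0 (v - w)) M = 0 := by
      rw [hM, Matrix.vecMul_fromBlocks]
      ext i
      rcases i with i | i <;> simp [Matrix.vecMul_neg, hz]
    have h3 := Matrix.eq_zero_of_vecMul_eq_zero hdet h2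
    have h4 : v - w = 0 := by
      ext i
      exact congrFun h3 (Sum.inr i)
    exact sub_eq_zero.1 h4
  have := (Matrix.vecMul_injective_iff.1 hinj).rank_matrix
  simpa using this
end

section
/- Let A₂₂ be a real m×m matrix, A₁₂ a real p×m matrix, L a real m×p matrix, F a real m×k matrix, and G a real k×p matrix. If the (m+k)×(m+k) real block matrix Ω = [[A₂₂ − L·A₁₂, F], [−G·A₁₂, 0]] is Hurwitz stable, then the pair (A₂₂, A₁₂) is detectable, i.e., for every complex s with Re(s) ≥ 0 the (p+m)×m complex matrix obtained by stacking A₁₂ on top of s·I_m − A₂₂ (entries embedded into ℂ) has rank m. -/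
/-- Claim (48), necessity direction of Theorem 2: if the block matrix
`[[A₂₂ − L·A₁₂, F], [−G·A₁₂, 0]]` is Hurwitz stable, then the pair `(A₂₂, A₁₂)`
is detectable, i.e. for every complex `s` with `Re(s) ≥ 0` the stacked matrix
`[[A₁₂], [s·I − A₂₂]]` has rank `m`. -/
theorem detectable_of_hurwitz {m p k : ℕ}
    (A₂₂ : Matrix (Fin m) (Fin m) ℝ) (A₁₂ : Matrix (Fin p) (Fin m) ℝ)
    (L : Matrix (Fin m) (Fin p) ℝ) (F : Matrix (Fin m) (Fin k) ℝ)
    (G : Matrix (Fin k) (Fin p) ℝ)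
    (hΩ : IsHurwitz (Matrix.fromBlocks (A₂₂ - L * A₁₂) F (-(G * A₁₂)) 0)) :
    ∀ s : ℂ, 0 ≤ s.re →
      (Matrix.fromRows (A₁₂.map Complex.ofReal)
        (s • (1 : Matrix (Fin m) (Fin m) ℂ) - A₂₂.map Complex.ofReal)).rank = m := by
  intro s hs
  rw [Matrix.rank, LinearMap.finrank_range_of_inj, Module.finrank_fin_fun]
  rw [← LinearMap.ker_eq_bot, LinearMap.ker_eq_bot']
  intro v hv
  by_contra hv0
  rw [Matrix.mulVecLin_apply, Matrix.fromRows_mulVec] at hv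
  have h1 : (A₁₂.map Complex.ofReal).mulVec v = 0 := by
    funext i
    exact congrFun hv (Sum.inl i)
  have h2 : (s • (1 : Matrix (Fin m) (Fin m) ℂ) - A₂₂.map Complex.ofReal).mulVec v = 0 := by
    funext i
    exact congrFun hv (Sum.inr i)
  have h3 : (A₂₂.map Complex.ofReal).mulVec v = s • v := by
    rw [Matrix.sub_mulVec, Matrix.smul_mulVec, Matrix.one_mulVec, sub_eq_zero] at h2
    exact h2.symm
  have e1 : (A₂₂ - L * A₁₂).map Complex.ofReal
      = A₂₂.map Complex.ofReal - L.map Complex.ofReal * A₁₂.map Complex.ofReal := by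
    ext i j
    simp [Matrix.mul_apply]
  have e2 : (-(G * A₁₂)).map Complex.ofReal
      = -(G.map Complex.ofReal * A₁₂.map Complex.ofReal) := by
    ext i j
    simp [Matrix.mul_apply]
  refine absurd (hΩ s ?_) (not_lt.mpr hs)
  rw [Polynomial.IsRoot.def, Matrix.eval_charpoly, ← Matrix.exists_mulVec_eq_zero_iff]
  refine ⟨Sum.elim v 0, ?_, ?_⟩
  · intro h
    apply hv0
    funext i
    exact congrFun h (Sum.inl i)
  · rw [Matrix.sub_mulVec, Matrix.fromBlocks_map, Matrix.fromBlocks_mulVec, e1, e2, sub_eq_zero]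
    rw [Matrix.scalar_apply, ← Matrix.smul_one_eq_diagonal, Matrix.smul_mulVec, Matrix.one_mulVec]
    simp only [Sum.elim_comp_inl, Sum.elim_comp_inr, Matrix.sub_mulVec, Matrix.neg_mulVec,
      ← Matrix.mulVec_mulVec, h1, h3, Matrix.mulVec_zero]
    funext i
    cases i <;> simp
end

section
/- Let A₂₂ be a real m×m matrix and A₁₂ a real p×m matrix with rank(A₁₂) = q, and let k be an integer with 1 ≤ k ≤ q. If the pair (A₂₂, A₁₂) is detectable, then there exist real matrices L (m×p), F (m×k), and G (k×p) with rank(G) = k such that the (m+k)×(m+k) real block matrix Ω = [[A₂₂ − L·A₁₂, F], [−G·A₁₂, 0]] is Hurwitz stable. -/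
section Aux
open Matrix
open scoped ComplexOrder

lemma aux_factor {n : Type*} [Fintype n] [DecidableEq n] (M N : Matrix n n ℂ)
    (h : ∀ v, M *ᵥ v = 0 → N *ᵥ v = 0) : ∃ B : Matrix n n ℂ, N = B * M := by
  obtain ⟨s, hs⟩ := (Matrix.toLin' M).rangeRestrict.exists_rightInverse_of_surjective
    (LinearMap.range_rangeRestrict _)
  obtain ⟨t, ht⟩ := LinearMap.exists_extend s
  refine ⟨LinearMap.toMatrix' (Matrix.toLin' N ∘ₗ t), ?_⟩
  apply Matrix.toLin'.injective
  rw [Matrix.toLin'_mul, Matrix.toLin'_toMatrix']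
  refine LinearMap.ext fun u => ?_
  have h1 : t (Matrix.toLin' M u) = s ((Matrix.toLin' M).rangeRestrict u) := by
    rw [← ht]; rfl
  have h2 : M *ᵥ (u - t (Matrix.toLin' M u)) = 0 := by
    rw [h1]
    have := congrArg Subtype.val (LinearMap.congr_fun hs ((Matrix.toLin' M).rangeRestrict u))
    simp at this
    simp [Matrix.mulVec_sub, this]
  have h3 := h _ h2
  rw [Matrix.mulVec_sub, sub_eq_zero] at h3
  simpa using h3

lemma psd_map {n : Type*} [Fintype n] [DecidableEq n] {M : Matrix n n ℝ} (h : M.PosSemidef) :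
    (M.map Complex.ofReal).PosSemidef := by
  open scoped MatrixOrder in
  obtain ⟨B, rfl⟩ := CStarAlgebra.nonneg_iff_eq_star_mul_self.mp h.nonneg
  have : (star B * B).map Complex.ofReal
      = (B.map Complex.ofReal)ᴴ * (B.map Complex.ofReal) := by
    ext i j
    simp [Matrix.mul_apply, Matrix.star_apply]
  rw [this]
  exact posSemidef_conjTranspose_mul_self _

lemma pd_map {n : Type*} [Fintype n] [DecidableEq n] {M : Matrix n n ℝ} (h : M.PosDef) :
    (M.map Complex.ofReal).PosDef := by
  rw [(psd_map h.posSemidef).posDef_iff_isUnit]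
  exact h.isUnit.map (Complex.ofRealHom.mapMatrix)

lemma aux_eig {n : Type*} [Fintype n] [DecidableEq n] (A X : Matrix n n ℂ)
    (hX : X.PosSemidef) (hX0 : X ≠ 0) (hZ : (A * X + X * Aᴴ).PosSemidef) :
    ∃ (l : ℂ) (w : n → ℂ), X *ᵥ w ≠ 0 ∧ A *ᵥ (X *ᵥ w) = l • (X *ᵥ w) ∧ 0 ≤ l.re := by
  have hXh : Xᴴ = X := hX.1
  obtain ⟨B, hB⟩ := aux_factor X (X * Aᴴ) (by
    intro v hv
    have h1 : (A * X + X * Aᴴ) *ᵥ v = 0 := by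
      rw [← hZ.dotProduct_mulVec_zero_iff, Matrix.add_mulVec, ← Matrix.mulVec_mulVec, hv,
        ← Matrix.mulVec_mulVec, mulVec_zero, zero_add, dotProduct_mulVec]
      have : star v ᵥ* X = star (X *ᵥ v) := by
        rw [star_mulVec, hXh]
      rw [this, hv]; simp
    rw [Matrix.add_mulVec, ← Matrix.mulVec_mulVec, hv] at h1
    simpa using h1)
  have hB' : A * X = X * Bᴴ := by
    have := congrArg conjTranspose hB
    simpa [hXh] using this
  let V := LinearMap.range (Matrix.toLin' X)
  have hV : ∀ x ∈ V, Matrix.toLin' A x ∈ V := by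
    rintro _ ⟨w, rfl⟩
    refine ⟨Bᴴ *ᵥ w, ?_⟩
    simp [hB']
  have hVn : Nontrivial V := by
    rw [Submodule.nontrivial_iff_ne_bot]
    intro h
    apply hX0
    have := LinearMap.range_eq_bot.mp h
    simpa using this
  obtain ⟨l, hl⟩ := Module.End.exists_eigenvalue ((Matrix.toLin' A).restrict hV)
  obtain ⟨⟨x, w, hw⟩, hx, hx0⟩ := hl.exists_hasEigenvector
  have hx := Module.End.mem_eigenspace_iff.mp hx
  have hx := congrArg Subtype.val hx
  subst hw
  have hne : X *ᵥ w ≠ 0 := by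
    intro h
    apply hx0
    ext1
    simpa using h
  have hx' : A *ᵥ (X *ᵥ w) = l • (X *ᵥ w) := by simpa using hx
  refine ⟨l, w, hne, hx', ?_⟩
  have h0 := hZ.dotProduct_mulVec_nonneg w
  have hp : 0 < star w ⬝ᵥ X *ᵥ w := lt_of_le_of_ne (hX.dotProduct_mulVec_nonneg w) (by
    intro h
    exact hne ((hX.dotProduct_mulVec_zero_iff w).mp h.symm))
  have e1 : star w ⬝ᵥ (X * Aᴴ) *ᵥ w = star l * (star w ⬝ᵥ X *ᵥ w) := by
    have : star w ᵥ* (X * Aᴴ) = star (l • (X *ᵥ w)) := by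
      rw [← hx', star_mulVec, star_mulVec, hXh, vecMul_vecMul]
    rw [dotProduct_mulVec, this, star_smul, smul_dotProduct, star_mulVec, hXh, smul_eq_mul,
      dotProduct_mulVec]
  rw [add_mulVec, dotProduct_add, e1, ← mulVec_mulVec, hx', dotProduct_smul, smul_eq_mul] at h0
  generalize star w ⬝ᵥ X *ᵥ w = c at *
  rw [Complex.lt_def] at hp
  rw [Complex.le_def] at h0
  simp at hp h0
  have := hp.2
  rw [← this] at h0
  nlinarith [h0.1, hp.1]

lemma aux_open (m : ℕ) : IsOpen {M : Fin m → Fin m → ℝ | ∀ x : Fin m → ℝ, x ≠ 0 →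
    x ⬝ᵥ (Matrix.of M) *ᵥ x < 0} := by
  have : {M : Fin m → Fin m → ℝ | ∀ x : Fin m → ℝ, x ≠ 0 → x ⬝ᵥ (Matrix.of M) *ᵥ x < 0}
      = {M | ∀ x ∈ Metric.sphere (0 : Fin m → ℝ) 1, x ⬝ᵥ (Matrix.of M) *ᵥ x < 0} := by
    ext M
    constructor
    · intro h x hx
      exact h x (by rintro rfl; simp at hx)
    · intro h x hx
      have hn : 0 < ‖x‖ := norm_pos_iff.mpr hx
      have := h (‖x‖⁻¹ • x) (by simp [norm_smul, hn.ne'])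
      rw [mulVec_smul, smul_dotProduct, dotProduct_smul, smul_eq_mul, smul_eq_mul] at this
      have h2 : 0 < ‖x‖⁻¹ := inv_pos.mpr hn
      by_contra! h3
      have := mul_nonneg h2.le (mul_nonneg h2.le h3)
      linarith
  rw [this, isOpen_iff_eventually]
  intro M hM
  apply (isCompact_sphere (0 : Fin m → ℝ) 1).eventually_forall_of_forall_eventually
  intro y hy
  have hc : Continuous fun z : (Fin m → Fin m → ℝ) × (Fin m → ℝ) =>
      z.2 ⬝ᵥ (Matrix.of z.1) *ᵥ z.2 := by
    simp only [dotProduct, mulVec, Matrix.of_apply]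
    fun_prop
  exact hc.continuousAt.eventually_lt continuousAt_const (hM y hy)

lemma aux_final {n k : Type*} [Fintype n] [Fintype k] [DecidableEq n] [DecidableEq k]
    (A P Q : Matrix n n ℂ) (F : Matrix n k ℂ) (H : Matrix k n ℂ)
    (hP : P.PosDef) (hQ : Q.PosDef) (h1 : Aᴴ * P + P * A = -Q) (h2 : P * F = Hᴴ)
    (hH : ∀ y, Hᴴ *ᵥ y = 0 → y = 0) (l : ℂ) (x : n → ℂ) (y : k → ℂ)
    (e1 : A *ᵥ x + F *ᵥ y = l • x) (e2 : -(H *ᵥ x) = l • y) (hne : ¬ (x = 0 ∧ y = 0)) :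
    l.re < 0 := by
  by_contra! hl
  have hx : x = 0 := by
    by_contra hx
    have hq := hQ.dotProduct_mulVec_pos hx
    have hp := hP.dotProduct_mulVec_pos hx
    have hy : 0 ≤ star y ⬝ᵥ y := dotProduct_star_self_nonneg y
    have b1 : star x ⬝ᵥ (P * A) *ᵥ x + star x ⬝ᵥ Hᴴ *ᵥ y = l * (star x ⬝ᵥ P *ᵥ x) := by
      rw [← h2, ← mulVec_mulVec, ← mulVec_mulVec, ← dotProduct_add, ← mulVec_add, e1, mulVec_smul,
        dotProduct_smul, smul_eq_mul]
    have b2 : star x ⬝ᵥ Hᴴ *ᵥ y = - (star l * (star y ⬝ᵥ y)) := by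
      rw [dotProduct_mulVec, ← star_mulVec]
      have : H *ᵥ x = - (l • y) := by rw [← e2, neg_neg]
      rw [this, star_neg, neg_dotProduct, star_smul, smul_dotProduct, smul_eq_mul]
    have b3 : star x ⬝ᵥ (Aᴴ * P) *ᵥ x = star (star x ⬝ᵥ (P * A) *ᵥ x) := by
      have hPh : Pᴴ = P := hP.1
      rw [star_dotProduct, star_mulVec, conjTranspose_mul, conjTranspose_conjTranspose, hPh,
        dotProduct_mulVec]
    have b4 : star x ⬝ᵥ (Aᴴ * P) *ᵥ x + star x ⬝ᵥ (P * A) *ᵥ x = - (star x ⬝ᵥ Q *ᵥ x) := by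
      rw [← dotProduct_add, ← add_mulVec, h1, neg_mulVec, dotProduct_neg]
    rw [b3] at b4
    rw [b2] at b1
    generalize star x ⬝ᵥ (P * A) *ᵥ x = a at *
    generalize star x ⬝ᵥ P *ᵥ x = c at *
    generalize star x ⬝ᵥ Q *ᵥ x = d at *
    generalize star y ⬝ᵥ y = f at *
    rw [Complex.lt_def] at hp hq
    rw [Complex.le_def] at hy
    have b1 := congrArg Complex.re b1
    have b4 := congrArg Complex.re b4
    simp at hp hq hy b1 b4
    rw [← hp.2, ← hy.2] at b1
    nlinarith [mul_nonneg hl hp.1.le, mul_nonneg hl hy.1]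
  apply hne
  refine ⟨hx, hH y ?_⟩
  subst hx
  rw [← h2, ← mulVec_mulVec]
  simp at e1
  rw [e1, mulVec_zero]

lemma aux_eps {a b : ℝ} (h : ∀ ε : ℝ, 0 < ε → 0 ≤ a + ε * b) : 0 ≤ a := by
  by_contra! ha
  rcases le_or_gt b 0 with hb | hb
  · have := h 1 one_pos
    linarith
  · have := h (-a / (2 * b)) (by apply div_pos <;> linarith)
    have e : -a / (2 * b) * b = -a / 2 := by field_simp
    rw [e] at this
    linarith

lemma aux_sep {m p : ℕ} (A : Matrix (Fin m) (Fin m) ℝ) (C : Matrix (Fin p) (Fin m) ℝ)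
    (hno : ¬ ∃ (P : Matrix (Fin m) (Fin m) ℝ) (g : ℝ), P.PosDef ∧ 0 ≤ g ∧
      (g • (Cᵀ * C) - (Aᵀ * P + P * A)).PosDef) :
    ∃ f : Matrix (Fin m) (Fin m) ℝ →ₗ[ℝ] ℝ, 0 < f 1 ∧ (∀ v, 0 ≤ f (vecMulVec v v)) ∧
      (∀ v, 0 ≤ f (Aᵀ * vecMulVec v v + vecMulVec v v * A)) ∧ f (Cᵀ * C) ≤ 0 := by
  let N : Set (Fin m → Fin m → ℝ) :=
    {M | ∀ x : Fin m → ℝ, x ≠ 0 → x ⬝ᵥ (Matrix.of M) *ᵥ x < 0}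
  let S : Set (Fin m → Fin m → ℝ) :=
    {M | ∃ (P : Matrix (Fin m) (Fin m) ℝ) (g : ℝ), P.PosDef ∧ 0 ≤ g ∧
      Matrix.of M = (Aᵀ * P + P * A) - g • (Cᵀ * C)}
  have hNs : ∀ M ∈ N, ∀ t : ℝ, 0 < t → t • M ∈ N := by
    intro M hM t ht x hx
    have := hM x hx
    have e : Matrix.of (t • M) = t • Matrix.of M := rfl
    rw [e, smul_mulVec, dotProduct_smul, smul_eq_mul]
    exact mul_neg_of_pos_of_neg ht this
  have hNa : ∀ M ∈ N, ∀ M' ∈ N, M + M' ∈ N := by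
    intro M hM M' hM' x hx
    have e : Matrix.of (M + M') = Matrix.of M + Matrix.of M' := rfl
    rw [e, add_mulVec, dotProduct_add]
    exact add_neg (hM x hx) (hM' x hx)
  have hSs : ∀ M ∈ S, ∀ t : ℝ, 0 < t → t • M ∈ S := by
    rintro M ⟨P, g, hP, hg, hM⟩ t ht
    refine ⟨t • P, t * g, hP.smul ht, by positivity, ?_⟩
    have e : Matrix.of (t • M) = t • Matrix.of M := rfl
    rw [e, hM, smul_sub, smul_add, smul_smul]
    simp
  have hSa : ∀ M ∈ S, ∀ M' ∈ S, M + M' ∈ S := by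
    rintro M ⟨P, g, hP, hg, hM⟩ M' ⟨P', g', hP', hg', hM'⟩
    refine ⟨P + P', g + g', hP.add hP', by positivity, ?_⟩
    have e : Matrix.of (M + M') = Matrix.of M + Matrix.of M' := rfl
    rw [e, hM, hM', add_smul, mul_add, add_mul]
    abel
  have hconv : ∀ K : Set (Fin m → Fin m → ℝ), (∀ M ∈ K, ∀ t : ℝ, 0 < t → t • M ∈ K) →
      (∀ M ∈ K, ∀ M' ∈ K, M + M' ∈ K) → Convex ℝ K := by
    intro K h1 h2
    rw [convex_iff_forall_pos]
    intro x hx y hy a b ha hb _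
    exact h2 _ (h1 x hx a ha) _ (h1 y hy b hb)
  have hdisj : Disjoint N S := by
    rw [Set.disjoint_left]
    rintro M hM ⟨P, g, hP, hg, hMe⟩
    apply hno
    refine ⟨P, g, hP, hg, PosDef.of_dotProduct_mulVec_pos ?_ ?_⟩
    · have hPh : Pᵀ = P := by
        have := hP.1
        rwa [IsHermitian, conjTranspose_eq_transpose_of_trivial] at this
      rw [IsHermitian, conjTranspose_eq_transpose_of_trivial]
      simp [hPh, add_comm]
    · intro x hx
      have := hM x hx
      rw [hMe, ← neg_sub, neg_mulVec, dotProduct_neg] at this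
      simpa using this
  obtain ⟨f, u, hfN, hfS⟩ := geometric_hahn_banach_open (hconv N hNs hNa) (aux_open m)
    (hconv S hSs hSa) hdisj
  let f' : Matrix (Fin m) (Fin m) ℝ →ₗ[ℝ] ℝ := f.toLinearMap
  have hu : u ≤ 0 := by
    have h1 : ((Aᵀ * 1 + 1 * A) - (0 : ℝ) • (Cᵀ * C)) ∈ S := ⟨1, 0, PosDef.one, le_rfl, rfl⟩
    have : 0 ≤ -u := aux_eps (b := f' ((Aᵀ * 1 + 1 * A) - (0 : ℝ) • (Cᵀ * C))) (by
      intro ε hε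
      have h2 := hfS _ (hSs _ h1 ε hε)
      have h3 : f' (ε • ((Aᵀ * 1 + 1 * A) - (0 : ℝ) • (Cᵀ * C)))
        = ε * f' ((Aᵀ * 1 + 1 * A) - (0 : ℝ) • (Cᵀ * C)) := by rw [map_smul, smul_eq_mul]
      have h4 : u ≤ f' (ε • ((Aᵀ * 1 + 1 * A) - (0 : ℝ) • (Cᵀ * C))) := h2
      linarith)
    linarith
  have hpd : ∀ M : Matrix (Fin m) (Fin m) ℝ, M.PosDef → 0 < f' M := by
    intro M hM
    have h1 : (-M) ∈ N := by
      intro x hx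
      have := hM.dotProduct_mulVec_pos hx
      change x ⬝ᵥ (-M) *ᵥ x < 0
      rw [neg_mulVec, dotProduct_neg]
      simpa using this
    have h2 : f' (-M) < u := hfN _ h1
    rw [map_neg] at h2
    linarith
  have hS0 : ∀ (P : Matrix (Fin m) (Fin m) ℝ) (g : ℝ), P.PosDef → 0 ≤ g →
      0 ≤ f' (Aᵀ * P + P * A) - g * f' (Cᵀ * C) := by
    intro P g hP hg
    have h1 : ((Aᵀ * P + P * A) - g • (Cᵀ * C)) ∈ S := ⟨P, g, hP, hg, rfl⟩
    rw [← smul_eq_mul g, ← map_smul, ← map_sub]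
    refine aux_eps (b := 0) ?_
    intro ε hε
    by_contra! hlt
    simp only [mul_zero, add_zero] at hlt
    set W := f' ((Aᵀ * P + P * A) - g • (Cᵀ * C)) with hW
    have h2 : ∀ t : ℝ, 0 < t → u ≤ t * W := by
      intro t ht
      have h3 : u ≤ f' (t • ((Aᵀ * P + P * A) - g • (Cᵀ * C))) := hfS _ (hSs _ h1 t ht)
      rwa [map_smul, smul_eq_mul] at h3
    have h3 := h2 ((u - 1) / W) (div_pos_of_neg_of_neg (by linarith) hlt)
    rw [div_mul_cancel₀ _ hlt.ne] at h3
    linarith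
  have hvv : ∀ (v : Fin m → ℝ) (ε : ℝ), 0 < ε →
      (vecMulVec v v + ε • (1 : Matrix (Fin m) (Fin m) ℝ)).PosDef := by
    intro v ε hε
    have := posSemidef_vecMulVec_self_star v
    exact PosDef.posSemidef_add (by simpa using this) (PosDef.one.smul hε)
  refine ⟨f', hpd 1 PosDef.one, ?_, ?_, ?_⟩
  · intro v
    refine aux_eps (b := f' 1) ?_
    intro ε hε
    have := hpd _ (hvv v ε hε)
    rw [map_add, map_smul, smul_eq_mul] at this
    exact this.le
  · intro v
    refine aux_eps (b := f' (Aᵀ + A)) ?_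
    intro ε hε
    have := hS0 _ 0 (hvv v ε hε) le_rfl
    rw [zero_mul, sub_zero] at this
    rw [← smul_eq_mul ε, ← map_smul, ← map_add]
    convert this using 2
    simp [mul_add, add_mul]
    abel
  · have : 0 ≤ -f' (Cᵀ * C) := by
      refine aux_eps (b := f' (Aᵀ * 1 + 1 * A)) ?_
      intro ε hε
      have := hS0 1 ε⁻¹ PosDef.one (by positivity)
      have h2 := mul_nonneg hε.le this
      rw [mul_sub, ← mul_assoc, mul_inv_cancel₀ hε.ne'] at h2
      linarith
    linarith

lemma aux_lmi {m p : ℕ} (A : Matrix (Fin m) (Fin m) ℝ) (C : Matrix (Fin p) (Fin m) ℝ)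
    (hdet : ∀ s : ℂ, 0 ≤ s.re → ∀ v : Fin m → ℂ, C.map Complex.ofReal *ᵥ v = 0 →
      A.map Complex.ofReal *ᵥ v = s • v → v = 0) :
    ∃ (P : Matrix (Fin m) (Fin m) ℝ) (g : ℝ), P.PosDef ∧ 0 ≤ g ∧
      (g • (Cᵀ * C) - (Aᵀ * P + P * A)).PosDef := by
  by_contra hno
  obtain ⟨f, hf1, hfv, hfA, hfC⟩ := aux_sep A C hno
  let Y : Matrix (Fin m) (Fin m) ℝ := Matrix.of fun i j => f (Matrix.single i j 1)
  have hfY : ∀ a b : Fin m → ℝ, f (vecMulVec a b) = a ⬝ᵥ Y *ᵥ b := by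
    intro a b
    conv_lhs => rw [matrix_eq_sum_single (vecMulVec a b)]
    simp only [map_sum, dotProduct, mulVec, Finset.mul_sum, Y, Matrix.of_apply]
    refine Finset.sum_congr rfl fun i _ => Finset.sum_congr rfl fun j _ => ?_
    have : Matrix.single i j (vecMulVec a b i j) = (a i * b j) • Matrix.single i j (1 : ℝ) := by
      simp [vecMulVec_apply, Matrix.smul_single]
    rw [this, map_smul, smul_eq_mul]
    ring
  let X := Y + Yᵀ
  have hXab : ∀ a b : Fin m → ℝ, a ⬝ᵥ X *ᵥ b = f (vecMulVec a b) + f (vecMulVec b a) := by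
    intro a b
    rw [hfY, hfY, add_mulVec, dotProduct_add, mulVec_transpose, dotProduct_comm a (b ᵥ* Y),
      dotProduct_mulVec b]
  have hXt : Xᵀ = X := by simp [X, add_comm]
  have hX : X.PosSemidef := by
    refine PosSemidef.of_dotProduct_mulVec_nonneg ?_ ?_
    · rw [IsHermitian, conjTranspose_eq_transpose_of_trivial, hXt]
    · intro v
      rw [star_trivial, hXab]
      linarith [hfv v]
  have hX0 : X ≠ 0 := by
    intro h
    have hz : ∀ a, f (vecMulVec a a) = 0 := by
      intro a
      have := hXab a a
      rw [h, zero_mulVec, dotProduct_zero] at this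
      linarith
    have h1 : (1 : Matrix (Fin m) (Fin m) ℝ)
        = ∑ i, vecMulVec (Pi.single i 1) (Pi.single i 1) := by
      ext i j
      simp [Matrix.sum_apply, vecMulVec_apply, Matrix.one_apply, Pi.single_apply]
    rw [h1, map_sum] at hf1
    simp [hz] at hf1
  have hZ : (A * X + X * Aᵀ).PosSemidef := by
    refine PosSemidef.of_dotProduct_mulVec_nonneg ?_ ?_
    · rw [IsHermitian, conjTranspose_eq_transpose_of_trivial]
      simp [hXt, add_comm]
    · intro v
      have e : f (vecMulVec (Aᵀ *ᵥ v) v) + f (vecMulVec v (Aᵀ *ᵥ v))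
          = f (Aᵀ * vecMulVec v v + vecMulVec v v * A) := by
        rw [← map_add, mul_vecMulVec, vecMulVec_mul, mulVec_transpose]
      have e1 := hXab (Aᵀ *ᵥ v) v
      have e2 := hXab v (Aᵀ *ᵥ v)
      have := hfA v
      rw [star_trivial, add_mulVec, dotProduct_add, ← mulVec_mulVec, ← mulVec_mulVec,
        dotProduct_mulVec v A, ← mulVec_transpose]
      linarith
  have hCX : C * X = 0 := by
    have h1 : Cᵀ * C = ∑ i, vecMulVec (C.row i) (C.row i) := by
      ext a b
      simp [Matrix.sum_apply, vecMulVec_apply, Matrix.mul_apply]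
    have h2 : ∑ i, f (vecMulVec (C.row i) (C.row i)) = 0 := by
      rw [← map_sum, ← h1]
      refine le_antisymm hfC ?_
      rw [h1, map_sum]
      exact Finset.sum_nonneg fun i _ => hfv _
    rw [Finset.sum_eq_zero_iff_of_nonneg (fun i _ => hfv (C.row i))] at h2
    have h3 : ∀ i, X *ᵥ (C.row i) = 0 := by
      intro i
      rw [← hX.dotProduct_mulVec_zero_iff, star_trivial, hXab, h2 i (Finset.mem_univ i), add_zero]
    have h4 : X * Cᵀ = 0 := by
      ext a i
      exact congrFun (h3 i) a
    have := congrArg transpose h4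
    simpa [hXt] using this
  have hm : ∀ {a b c : ℕ} (M : Matrix (Fin a) (Fin b) ℝ) (N : Matrix (Fin b) (Fin c) ℝ),
      (M * N).map Complex.ofReal = M.map Complex.ofReal * N.map Complex.ofReal := by
    intro a b c M N
    exact Matrix.map_mul (f := Complex.ofRealHom)
  obtain ⟨l, w, hw, hAw, hl⟩ := aux_eig (A.map Complex.ofReal) (X.map Complex.ofReal)
    (psd_map hX) (by
      intro h
      apply hX0
      ext i j
      have := congrFun (congrFun h i) j
      simpa using this) (by
      have := psd_map hZ
      have e : (A * X + X * Aᵀ).map Complex.ofReal = A.map Complex.ofReal * X.map Complex.ofReal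
          + X.map Complex.ofReal * (A.map Complex.ofReal)ᴴ := by
        rw [Matrix.map_add _ (by simp), hm, hm]
        congr 2
        ext i j
        simp
      rwa [e] at this)
  refine hw (hdet l hl _ ?_ hAw)
  rw [mulVec_mulVec, ← hm, hCX]
  ext i
  simp [mulVec, dotProduct]

lemma aux_G {m p k : ℕ} (C : Matrix (Fin p) (Fin m) ℝ) (hk : k ≤ C.rank) :
    ∃ (G : Matrix (Fin k) (Fin p) ℝ) (R : Matrix (Fin m) (Fin k) ℝ), G * C * R = 1 := by
  rw [← Matrix.rank_transpose] at hk
  obtain ⟨v, hv⟩ := exists_linearIndependent_of_le_finrank hk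
  have hv' : LinearIndependent ℝ fun i => (v i : Fin m → ℝ) :=
    hv.map' (Submodule.subtype _) (Submodule.ker_subtype _)
  have : ∀ i, ∃ g, Cᵀ *ᵥ g = v i := fun i => (v i).2
  choose g hg using this
  let G : Matrix (Fin k) (Fin p) ℝ := Matrix.of g
  have hrow : ∀ i, (G * C).row i = v i := by
    intro i
    rw [← hg i, mulVec_transpose]
    rfl
  have hli : LinearIndependent ℝ (G * C).row := by
    convert hv' using 1
    funext i
    exact hrow i
  have hr := hli.rank_matrix
  refine ⟨G, ?_⟩
  rw [← mulVec_surjective_iff_exists_right_inverse]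
  have : LinearMap.range (G * C).mulVecLin = ⊤ := by
    apply Submodule.eq_top_of_finrank_eq
    rw [← Matrix.rank, hr]
    simp
  exact LinearMap.range_eq_top.mp this

lemma aux_main {m p k : ℕ}
    (A : Matrix (Fin m) (Fin m) ℝ) (C : Matrix (Fin p) (Fin m) ℝ) (hk : k ≤ C.rank)
    (hdet : ∀ s : ℂ, 0 ≤ s.re → ∀ v : Fin m → ℂ, C.map Complex.ofReal *ᵥ v = 0 →
      A.map Complex.ofReal *ᵥ v = s • v → v = 0) :
    ∃ (L : Matrix (Fin m) (Fin p) ℝ) (F : Matrix (Fin m) (Fin k) ℝ)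
      (G : Matrix (Fin k) (Fin p) ℝ),
      G.rank = k ∧
        IsHurwitz (Matrix.fromBlocks (A - L * C) F (-(G * C)) 0) := by
  obtain ⟨P, g, hP, hg, hQ⟩ := aux_lmi A C hdet
  obtain ⟨G, R, hGR⟩ := aux_G C hk
  have hPt : Pᵀ = P := by
    have := hP.1
    rwa [IsHermitian, conjTranspose_eq_transpose_of_trivial] at this
  have hPP : P * P⁻¹ = 1 := Matrix.mul_nonsing_inv _ ((isUnit_iff_isUnit_det P).mp hP.isUnit)
  have hm : ∀ {a b c : ℕ} (M : Matrix (Fin a) (Fin b) ℝ) (N : Matrix (Fin b) (Fin c) ℝ),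
      (M * N).map Complex.ofReal = M.map Complex.ofReal * N.map Complex.ofReal := by
    intro a b c M N
    exact Matrix.map_mul (f := Complex.ofRealHom)
  have ht : ∀ {a b : ℕ} (M : Matrix (Fin a) (Fin b) ℝ),
      Mᵀ.map Complex.ofReal = (M.map Complex.ofReal)ᴴ := by
    intro a b M
    ext i j
    simp
  have hn : ∀ {a b : ℕ} (M : Matrix (Fin a) (Fin b) ℝ),
      (-M).map Complex.ofReal = -(M.map Complex.ofReal) := by
    intro a b M
    ext i j
    simp
  refine ⟨P⁻¹ * ((g / 2) • Cᵀ), P⁻¹ * (G * C)ᵀ, G, ?_, ?_⟩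
  · apply le_antisymm
    · simpa using G.rank_le_height
    · have h1 : (G * C * R).rank = k := by rw [hGR]; simp
      rw [Matrix.mul_assoc] at h1
      calc k = _ := h1.symm
        _ ≤ _ := Matrix.rank_mul_le_left _ _
  · intro z hz
    set A0 := A - P⁻¹ * ((g / 2) • Cᵀ) * C with hA0
    have i1 : A0ᵀ * P + P * A0 = -(g • (Cᵀ * C) - (Aᵀ * P + P * A)) := by
      have j1 : P * A0 = P * A - (g / 2) • (Cᵀ * C) := by
        rw [hA0, mul_sub, ← Matrix.mul_assoc, ← Matrix.mul_assoc, hPP, Matrix.one_mul,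
          Matrix.smul_mul]
      have j2 : A0ᵀ * P = (P * A0)ᵀ := by rw [transpose_mul, hPt]
      have hgg : g • (Cᵀ * C) = (g / 2) • (Cᵀ * C) + (g / 2) • (Cᵀ * C) := by
        rw [← add_smul, add_halves]
      rw [j2, j1, hgg]
      simp only [transpose_sub, transpose_mul, transpose_smul, transpose_transpose, hPt]
      abel
    have i2 : P * (P⁻¹ * (G * C)ᵀ) = (G * C)ᵀ := by
      rw [← Matrix.mul_assoc, hPP, Matrix.one_mul]
    rw [Polynomial.IsRoot, eval_charpoly] at hz
    obtain ⟨v, hv0, hv⟩ := exists_mulVec_eq_zero_iff.mpr hz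
    rw [sub_mulVec, sub_eq_zero, fromBlocks_map, fromBlocks_mulVec] at hv
    have hs : ∀ i, (scalar (Fin m ⊕ Fin k) z *ᵥ v) i = z * v i := fun i => by
      rw [scalar_apply, mulVec_diagonal]
    refine aux_final (A0.map Complex.ofReal) (P.map Complex.ofReal) _
      ((P⁻¹ * (G * C)ᵀ).map Complex.ofReal) ((G * C).map Complex.ofReal)
      (pd_map hP) (pd_map hQ) ?_ ?_ ?_ z (v ∘ Sum.inl) (v ∘ Sum.inr) ?_ ?_ ?_
    · rw [← ht, ← hm, ← hm, ← hn, ← i1, Matrix.map_add _ (by simp)]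
    · rw [← hm, i2, ht]
    · intro y hy
      have : ((G * C * R).map Complex.ofReal)ᴴ *ᵥ y = 0 := by
        rw [hm, conjTranspose_mul, ← mulVec_mulVec, hy, mulVec_zero]
      rw [hGR, Matrix.map_one _ (by simp) (by simp)] at this
      simpa using this
    · funext i
      have := congrFun hv (Sum.inl i)
      rw [hs] at this
      simpa using this.symm
    · funext i
      have := congrFun hv (Sum.inr i)
      rw [hs, hn] at this
      simpa [neg_mulVec] using this.symm
    · rintro ⟨h1, h2⟩
      apply hv0
      funext i
      rcases i with i | i
      · exact congrFun h1 i
      · exact congrFun h2 i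

lemma aux_hautus {m p : ℕ} (A : Matrix (Fin m) (Fin m) ℂ) (C : Matrix (Fin p) (Fin m) ℂ) (s : ℂ)
    (h : (Matrix.fromRows C (s • (1 : Matrix (Fin m) (Fin m) ℂ) - A)).rank = m)
    (v : Fin m → ℂ) (h1 : C *ᵥ v = 0) (h2 : A *ᵥ v = s • v) : v = 0 := by
  set M := Matrix.fromRows C (s • (1 : Matrix (Fin m) (Fin m) ℂ) - A) with hM
  have hk : LinearMap.ker M.mulVecLin = ⊥ := by
    have := LinearMap.finrank_range_add_finrank_ker M.mulVecLin
    rw [← Matrix.rank, h] at this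
    simp at this
    exact this
  have : v ∈ LinearMap.ker M.mulVecLin := by
    rw [LinearMap.mem_ker, mulVecLin_apply, hM, fromRows_mulVec, h1, sub_mulVec, h2, smul_mulVec,
      one_mulVec, sub_self]
    ext i
    rcases i with i | i <;> rfl
  rw [hk] at this
  simpa using this

end Aux

/-- Sufficiency direction of Theorem 2: if `rank A₁₂ = q`, `1 ≤ k ≤ q`, and the
pair `(A₂₂, A₁₂)` is detectable, then there exist `L`, `F`, `G` with `rank G = k`
such that the block matrix `[[A₂₂ − L·A₁₂, F], [−G·A₁₂, 0]]` is Hurwitz stable. -/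
theorem exists_observer_matrices_of_detectable {m p k q : ℕ}
    (A₂₂ : Matrix (Fin m) (Fin m) ℝ) (A₁₂ : Matrix (Fin p) (Fin m) ℝ)
    (hq : A₁₂.rank = q) (hk1 : 1 ≤ k) (hkq : k ≤ q)
    (hdet : ∀ s : ℂ, 0 ≤ s.re →
      (Matrix.fromRows (A₁₂.map Complex.ofReal)
        (s • (1 : Matrix (Fin m) (Fin m) ℂ) - A₂₂.map Complex.ofReal)).rank = m) :
    ∃ (L : Matrix (Fin m) (Fin p) ℝ) (F : Matrix (Fin m) (Fin k) ℝ)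
      (G : Matrix (Fin k) (Fin p) ℝ),
      G.rank = k ∧
        IsHurwitz (Matrix.fromBlocks (A₂₂ - L * A₁₂) F (-(G * A₁₂)) 0) := by
  subst hq
  exact aux_main A₂₂ A₁₂ hkq fun s hs v h1 h2 => aux_hautus _ _ s (hdet s hs) v h1 h2
end

section
/- Let A be a real n×n matrix and C a real p×n matrix. Then the pair (A, C) is observable if and only if for every monic polynomial c(s) with real coefficients of degree n there exists a real n×p matrix K such that the characteristic polynomial of A + K·C equals c(s). -/
open Polynomial

namespace PoleAux

variable {k V : Type*} [Field k] [AddCommGroup V] [Module k V]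

/-- `u` is a cyclic vector for `M`. -/
def Cyc (M : Module.End k V) (u : V) : Prop :=
  ∀ W : Submodule k V, u ∈ W → (∀ x ∈ W, M x ∈ W) → W = ⊤

lemma horner (M : Module.End k V) (u : V) (a : k[X]) (n : ℕ) (ha : a.Monic)
    (hn : a.natDegree = n) (h : ℕ → V) (h0 : h 0 = u)
    (hs : ∀ j < n, h (j + 1) = M (h j) + a.coeff (n - 1 - j) • u) :
    h n = aeval M a u := by
  have key : ∀ j m, j + m = n →
      h j = ∑ i ∈ Finset.range (j + 1), a.coeff (m + i) • (M ^ i) u := by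
    intro j
    induction j with
    | zero =>
      intro m hm
      have : a.coeff m = 1 := by
        have : m = a.natDegree := by omega
        rw [this]; exact ha
      simp [h0, this]
    | succ j ih =>
      intro m hm
      rw [hs j (by omega), ih (m + 1) (by omega), Finset.sum_range_succ' _ (j + 1), map_sum]
      have e : n - 1 - j = m := by omega
      rw [e]
      congr 1
      · apply Finset.sum_congr rfl
        intro i _
        rw [map_smul, pow_succ', Module.End.mul_apply]
        congr 2
        ring
  rw [key n 0 (by omega), aeval_eq_sum_range, hn]
  simp

variable [FiniteDimensional k V]

lemma charpoly_of_cyc (N : Module.End k V) (u : V) (hu : Cyc N u) (c : k[X]) (hc : c.Monic)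
    (hd : c.natDegree = Module.finrank k V) (h : aeval N c u = 0) : N.charpoly = c := by
  by_contra hne
  set d := N.charpoly - c with hdd
  have hd0 : d ≠ 0 := sub_ne_zero.mpr hne
  have hdu : aeval N d u = 0 := by
    simp [hdd, h, LinearMap.aeval_self_charpoly]
  have hdeg : d.degree < (Module.finrank k V : ℕ) := by
    have := degree_sub_lt_left (p := N.charpoly) (q := c) ?_ N.charpoly_monic.ne_zero ?_
    · rwa [degree_eq_natDegree N.charpoly_monic.ne_zero, LinearMap.charpoly_natDegree] at this
    · rw [degree_eq_natDegree N.charpoly_monic.ne_zero, degree_eq_natDegree hc.ne_zero,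
        LinearMap.charpoly_natDegree, hd]
    · rw [N.charpoly_monic.leadingCoeff, hc.leadingCoeff]
  have hnd : d.natDegree < Module.finrank k V := (natDegree_lt_iff_degree_lt hd0).2 hdeg
  let φ : k[X] →ₗ[k] V := (LinearMap.applyₗ u) ∘ₗ (aeval N).toLinearMap
  have hφ : ∀ q, φ q = aeval N q u := fun q => rfl
  have h1 : LinearMap.range φ = ⊤ := by
    apply hu
    · exact ⟨1, by simp [hφ]⟩
    · rintro _ ⟨q, rfl⟩
      exact ⟨X * q, by simp [hφ]⟩
  have h2 : (degreeLT k d.natDegree).map φ = ⊤ := by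
    rw [eq_top_iff]
    intro x _
    obtain ⟨q, rfl⟩ : x ∈ LinearMap.range φ := h1 ▸ Submodule.mem_top
    refine ⟨q % d, ?_, ?_⟩
    · rw [SetLike.mem_coe, mem_degreeLT, ← degree_eq_natDegree hd0]
      exact degree_mod_lt q hd0
    · conv_rhs => rw [← EuclideanDomain.mod_add_div q d]
      rw [map_add, hφ (d * _), mul_comm d, map_mul, Module.End.mul_apply, hdu]
      simp
  have h3 := Submodule.finrank_map_le φ (degreeLT k d.natDegree)
  rw [h2, finrank_top, (degreeLTEquiv k d.natDegree).finrank_eq] at h3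
  simp at h3
  omega

lemma single (M : Module.End k V) (u : V) (hu : Cyc M u) (c : k[X]) (hc : c.Monic)
    (hd : c.natDegree = Module.finrank k V) :
    ∃ f : V →ₗ[k] k, (M + f.smulRight u).charpoly = c := by
  set n := Module.finrank k V with hn
  set a := M.charpoly with ha
  let h : ℕ → V := fun j => Nat.rec u (fun j x => M x + a.coeff (n - 1 - j) • u) j
  have h0 : h 0 = u := rfl
  have hs : ∀ j, h (j + 1) = M (h j) + a.coeff (n - 1 - j) • u := fun j => rfl
  have hnz : h n = 0 := by
    rw [horner M u a n M.charpoly_monic (LinearMap.charpoly_natDegree M) h h0 (fun j _ => hs j), ha,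
      LinearMap.aeval_self_charpoly]
    rfl
  have hspan : Submodule.span k (Set.range fun i : Fin n => h i) = ⊤ := by
    have hm : ∀ j, j ≤ n → h j ∈ Submodule.span k (Set.range fun i : Fin n => h i) := by
      intro j hj
      rcases hj.lt_or_eq with hj | rfl
      · exact Submodule.subset_span ⟨⟨j, hj⟩, rfl⟩
      · rw [hnz]; exact zero_mem _
    apply hu
    · exact hm 0 (Nat.zero_le _)
    · intro x hx
      induction hx using Submodule.span_induction with
      | mem x hx =>
        obtain ⟨i, rfl⟩ := hx
        have : M (h i) = h (i + 1) - a.coeff (n - 1 - i) • u := by rw [hs]; abel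
        simp only [this]
        exact sub_mem (hm _ i.2) (Submodule.smul_mem _ _ (hm 0 (Nat.zero_le _)))
      | zero => simp
      | add x y _ _ hx hy => rw [map_add]; exact add_mem hx hy
      | smul r x _ hx => rw [map_smul]; exact Submodule.smul_mem _ _ hx
  let b : Module.Basis (Fin n) k V :=
    basisOfTopLeSpanOfCardEqFinrank (fun i : Fin n => h i) hspan.ge (by simp [hn])
  have hb : ∀ i : Fin n, b i = h i := fun i => by simp [b]
  let f : V →ₗ[k] k := b.constr k fun i => a.coeff (n - 1 - i) - c.coeff (n - 1 - i)
  have hf : ∀ j < n, f (h j) = a.coeff (n - 1 - j) - c.coeff (n - 1 - j) := by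
    intro j hj
    have := b.constr_basis k (fun i : Fin n => a.coeff (n - 1 - i) - c.coeff (n - 1 - i)) ⟨j, hj⟩
    rw [hb] at this
    exact this
  refine ⟨f, ?_⟩
  have hs' : ∀ j < n, h (j + 1) = (M + f.smulRight u) (h j) + c.coeff (n - 1 - j) • u := by
    intro j hj
    rw [LinearMap.add_apply, LinearMap.smulRight_apply, hf j hj, hs, sub_smul]
    abel
  apply charpoly_of_cyc _ u ?_ c hc hd
  · rw [← horner _ u c n hc hd h h0 hs', hnz]
  · intro W huW hW
    have : ∀ j ≤ n, h j ∈ W := by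
      intro j
      induction j with
      | zero => intro _; exact huW
      | succ j ih =>
        intro hj
        rw [hs' j hj]
        exact add_mem (hW _ (ih (by omega))) (W.smul_mem _ huW)
    rw [eq_top_iff, ← hspan, Submodule.span_le]
    rintro _ ⟨i, rfl⟩
    exact this i i.2.le

lemma seq (A : Module.End k V) (U : Submodule k V)
    (hU : ∀ W : Submodule k V, U ≤ W → (∀ x ∈ W, A x ∈ W) → W = ⊤) (m : ℕ)
    (hm : m ≤ Module.finrank k V) :
    ∃ v : ℕ → V, v 0 = 0 ∧ (∀ i < m, v (i + 1) - A (v i) ∈ U) ∧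
      LinearIndependent k (fun i : Fin m => v (i + 1)) := by
  induction m with
  | zero => exact ⟨0, rfl, by simp, linearIndependent_empty_type⟩
  | succ m ih =>
    obtain ⟨v, h0, hv, hl⟩ := ih (by omega)
    set W := Submodule.span k (Set.range fun i : Fin m => v (i + 1)) with hW
    have hmem : ∀ j ≤ m, v j ∈ W := by
      intro j hj
      cases j with
      | zero => rw [h0]; exact zero_mem _
      | succ j => exact Submodule.subset_span ⟨⟨j, hj⟩, rfl⟩
    have hne : W ≠ ⊤ := by
      intro h
      have := finrank_span_eq_card hl
      rw [← hW, h, finrank_top] at this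
      simp at this
      omega
    have : ∃ u ∈ U, A (v m) + u ∉ W := by
      by_contra! hcon
      apply hne
      have hA : A (v m) ∈ W := by simpa using hcon 0 (zero_mem _)
      have hUW : U ≤ W := fun u hu => by
        simpa using sub_mem (hcon u hu) hA
      apply hU W hUW
      intro x hx
      induction hx using Submodule.span_induction with
      | mem x hx =>
        obtain ⟨i, rfl⟩ := hx
        by_cases hi : i.1 + 1 = m
        · simp only [hi]; exact hA
        · have h1 := hUW (hv (i + 1) (by omega))
          have h2 := hmem (i + 1 + 1) (by omega)
          simpa using sub_mem h2 h1
      | zero => simp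
      | add x y _ _ hx hy => rw [map_add]; exact add_mem hx hy
      | smul r x _ hx => rw [map_smul]; exact Submodule.smul_mem _ _ hx
    obtain ⟨u, huU, hu⟩ := this
    refine ⟨Function.update v (m + 1) (A (v m) + u), ?_, ?_, ?_⟩
    · simp [Function.update, h0]
    · intro i hi
      rcases Nat.lt_succ_iff_lt_or_eq.1 hi with hi | rfl
      · rw [Function.update_of_ne (by omega), Function.update_of_ne (by omega)]
        exact hv i hi
      · rw [Function.update_self, Function.update_of_ne (by omega)]
        simpa using huU
    · have := linearIndependent_finSnoc.2 ⟨hl, hu⟩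
      convert this using 1
      ext i
      refine Fin.lastCases ?_ (fun i => ?_) i
      · simp
      · simp only [Fin.snoc_castSucc, Fin.val_castSucc]
        rw [Function.update_of_ne (by omega)]

lemma heymann (A : Module.End k V) (U : Submodule k V)
    (hU : ∀ W : Submodule k V, U ≤ W → (∀ x ∈ W, A x ∈ W) → W = ⊤)
    (hpos : 0 < Module.finrank k V) :
    ∃ G : Module.End k V, (∀ x, G x ∈ U) ∧ ∃ u ∈ U, Cyc (A + G) u := by
  obtain ⟨v, h0, hv, hl⟩ := seq A U hU _ le_rfl
  set n := Module.finrank k V with hn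
  let b : Module.Basis (Fin n) k V :=
    haveI : Nonempty (Fin n) := ⟨⟨0, hpos⟩⟩
    basisOfLinearIndependentOfCardEqFinrank hl (by simp [hn])
  have hb : ∀ i : Fin n, b i = v (i + 1) := fun i => by simp [b]
  let g : Fin n → V := fun i => if i.1 + 1 < n then v (i + 1 + 1) - A (v (i + 1)) else 0
  have hg : ∀ i, g i ∈ U := by
    intro i
    by_cases h : i.1 + 1 < n
    · simp only [g, h, if_true]; exact hv _ h
    · simp [g, h]
  let G : Module.End k V := b.constr k g
  have hG : ∀ j, j + 1 < n → (A + G) (v (j + 1)) = v (j + 1 + 1) := by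
    intro j hj
    have := b.constr_basis k g ⟨j, by omega⟩
    rw [hb] at this
    simp only [g, hj, if_true] at this
    rw [LinearMap.add_apply]
    simp only [G]
    rw [this]; abel
  refine ⟨G, ?_, v 1, ?_, ?_⟩
  · intro x
    simp only [G]
    rw [b.constr_apply_fintype k]
    exact sum_mem fun i _ => U.smul_mem _ (hg i)
  · simpa [h0] using hv 0 hpos
  · intro W hu hW
    have : ∀ j < n, v (j + 1) ∈ W := by
      intro j
      induction j with
      | zero => intro _; exact hu
      | succ j ih =>
        intro hj
        rw [← hG j hj]
        exact hW _ (ih (by omega))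
    rw [eq_top_iff, ← b.span_eq, Submodule.span_le]
    rintro _ ⟨i, rfl⟩
    rw [hb]
    exact this i i.2

lemma assign (A : Module.End k V) (U : Submodule k V)
    (hU : ∀ W : Submodule k V, U ≤ W → (∀ x ∈ W, A x ∈ W) → W = ⊤)
    (c : k[X]) (hc : c.Monic) (hd : c.natDegree = Module.finrank k V) :
    ∃ G : Module.End k V, (∀ x, G x ∈ U) ∧ (A + G).charpoly = c := by
  rcases Nat.eq_zero_or_pos (Module.finrank k V) with h | h
  · refine ⟨0, fun x => zero_mem _, ?_⟩
    rw [h] at hd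
    rw [hc.natDegree_eq_zero.1 hd, ← (LinearMap.charpoly_monic _).natDegree_eq_zero,
      LinearMap.charpoly_natDegree, h]
  · obtain ⟨G, hG, u, hu, hcyc⟩ := heymann A U hU h
    obtain ⟨f, hf⟩ := single _ u hcyc c hc hd
    refine ⟨G + f.smulRight u, fun x => ?_, by rw [← add_assoc]; exact hf⟩
    exact add_mem (hG x) (U.smul_mem _ hu)

open Matrix

lemma rank_iff {m n : ℕ} (A : Matrix (Fin n) (Fin n) ℂ) (C : Matrix (Fin m) (Fin n) ℂ) (s : ℂ) :
    (Matrix.fromRows C (s • (1 : Matrix (Fin n) (Fin n) ℂ) - A)).rank = n ↔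
      ∀ v, C *ᵥ v = 0 → A *ᵥ v = s • v → v = 0 := by
  set B := Matrix.fromRows C (s • (1 : Matrix (Fin n) (Fin n) ℂ) - A) with hB
  have h1 : B.rank = n ↔ LinearMap.ker B.mulVecLin = ⊥ := by
    have := LinearMap.finrank_range_add_finrank_ker B.mulVecLin
    rw [Module.finrank_fin_fun] at this
    rw [← Submodule.finrank_eq_zero, Matrix.rank]
    omega
  rw [h1, LinearMap.ker_eq_bot']
  apply forall_congr'
  intro v
  have : B.mulVecLin v = 0 ↔ C *ᵥ v = 0 ∧ A *ᵥ v = s • v := by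
    rw [Matrix.mulVecLin_apply, hB, Matrix.fromRows_mulVec]
    constructor
    · intro h
      refine ⟨funext fun i => congrFun h (Sum.inl i), ?_⟩
      have h2 : (s • (1 : Matrix (Fin n) (Fin n) ℂ) - A) *ᵥ v = 0 :=
        funext fun i => congrFun h (Sum.inr i)
      rw [Matrix.sub_mulVec, Matrix.smul_mulVec, Matrix.one_mulVec, sub_eq_zero] at h2
      exact h2.symm
    · rintro ⟨h2, h3⟩
      rw [h2, Matrix.sub_mulVec, Matrix.smul_mulVec, Matrix.one_mulVec, h3, sub_self]
      ext i; rcases i with i | i <;> rfl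
  rw [this]
  tauto

lemma complex_unobs {m n : ℕ} (A : Matrix (Fin n) (Fin n) ℂ) (C : Matrix (Fin m) (Fin n) ℂ)
    (h : ∀ s : ℂ, ∀ v, C *ᵥ v = 0 → A *ᵥ v = s • v → v = 0) (z : Fin n → ℂ)
    (hz : ∀ j : ℕ, (C * A ^ j) *ᵥ z = 0) : z = 0 := by
  by_contra hne
  let S : Submodule ℂ (Fin n → ℂ) := ⨅ j : ℕ, LinearMap.ker (C * A ^ j).mulVecLin
  have hS : ∀ x, x ∈ S ↔ ∀ j : ℕ, (C * A ^ j) *ᵥ x = 0 := by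
    intro x; simp [S, Submodule.mem_iInf]
  have hinv : ∀ x ∈ S, A.mulVecLin x ∈ S := by
    intro x hx
    rw [hS] at hx ⊢
    intro j
    rw [Matrix.mulVecLin_apply, Matrix.mulVec_mulVec, Matrix.mul_assoc, ← pow_succ]
    exact hx (j + 1)
  have : Nontrivial S := ⟨⟨⟨z, (hS z).2 hz⟩, 0, fun e => hne (congrArg Subtype.val e)⟩⟩
  obtain ⟨s, hs⟩ := Module.End.exists_eigenvalue (A.mulVecLin.restrict hinv)
  obtain ⟨v, hv⟩ := hs.exists_hasEigenvector
  apply hv.2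
  have h2 := congrArg Subtype.val hv.apply_eq_smul
  apply Subtype.ext
  apply h s
  · simpa using (hS v).1 v.2 0
  · exact h2

end PoleAux

open PoleAux Matrix in
/-- Paper's Lemma 2: the pair `(A, C)` is observable iff for every monic real
polynomial `c` of degree `n` there is a real matrix `K` such that the
characteristic polynomial of `A + K·C` equals `c`. -/
theorem observable_iff_pole_assignment {n p : ℕ}
    (A : Matrix (Fin n) (Fin n) ℝ) (C : Matrix (Fin p) (Fin n) ℝ) :
    (∀ s : ℂ,
        (Matrix.fromRows (C.map Complex.ofReal)
          (s • (1 : Matrix (Fin n) (Fin n) ℂ) - A.map Complex.ofReal)).rank = n) ↔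
      (∀ c : Polynomial ℝ, c.Monic → c.natDegree = n →
        ∃ K : Matrix (Fin n) (Fin p) ℝ, (A + K * C).charpoly = c) := by
  simp only [rank_iff]
  constructor
  · intro h c hc hd
    have hobs := complex_unobs _ _ h
    have hU : ∀ W : Submodule ℝ (Fin n → ℝ), LinearMap.range (Cᵀ).mulVecLin ≤ W →
        (∀ x ∈ W, (Aᵀ).mulVecLin x ∈ W) → W = ⊤ := by
      intro W hUW hW
      by_contra hne
      obtain ⟨f, hf0, hf⟩ := W.exists_le_ker_of_lt_top (lt_top_iff_ne_top.2 hne)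
      let x : Fin n → ℝ := fun i => f (Pi.single i 1)
      have hx : ∀ y, f y = x ⬝ᵥ y := by
        intro y
        conv_lhs => rw [pi_eq_sum_univ' y]
        simp [x, dotProduct, mul_comm]
      have hk : ∀ j : ℕ, ∀ y, ((Aᵀ) ^ j * Cᵀ) *ᵥ y ∈ W := by
        intro j y
        induction j with
        | zero => rw [pow_zero, Matrix.one_mul]; exact hUW ⟨y, rfl⟩
        | succ j ih =>
          have := hW _ ih
          rwa [Matrix.mulVecLin_apply, Matrix.mulVec_mulVec, ← Matrix.mul_assoc, ← pow_succ'] at this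
      have hCA : ∀ j : ℕ, (C * A ^ j) *ᵥ x = 0 := by
        intro j
        apply dotProduct_eq_zero
        intro y
        have h1 : f (((Aᵀ) ^ j * Cᵀ) *ᵥ y) = 0 := hf (hk j y)
        rw [hx, Matrix.dotProduct_mulVec, ← Matrix.mulVec_transpose] at h1
        simpa [Matrix.transpose_mul, Matrix.transpose_pow] using h1
      have hz := hobs (fun i => (x i : ℂ)) (by
        intro j
        have e : C.map Complex.ofReal * (A.map Complex.ofReal) ^ j
            = (C * A ^ j).map Complex.ofRealHom := by
          rw [Matrix.map_mul, Matrix.map_pow]; rfl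
        rw [e]
        ext i
        have := RingHom.map_mulVec Complex.ofRealHom (C * A ^ j) x i
        rw [hCA j] at this
        simpa [Function.comp_def] using this.symm)
      apply hf0
      have hx0 : x = 0 := by
        ext i
        have := congrFun hz i
        simpa using this
      ext1 y
      apply LinearMap.ext_ring
      change f (Pi.single y 1) = 0
      exact congrFun hx0 y
    obtain ⟨G, hG, hGc⟩ := assign (Aᵀ).mulVecLin (LinearMap.range (Cᵀ).mulVecLin) hU c hc
      (by simpa using hd)
    · choose F hF using fun i : Fin n => hG (Pi.single i 1)
      refine ⟨Matrix.of F, ?_⟩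
      rw [← Matrix.charpoly_transpose, ← Matrix.charpoly_mulVecLin, ← hGc]
      congr 1
      rw [Matrix.transpose_add, Matrix.transpose_mul, Matrix.mulVecLin_add]
      congr 1
      apply (Pi.basisFun ℝ (Fin n)).ext
      intro i
      rw [Pi.basisFun_apply, ← hF i, Matrix.mulVecLin_apply, ← Matrix.mulVec_mulVec,
        Matrix.mulVec_single_one]
      rfl
  · intro h s v hC hA
    by_contra hv
    have key : ∀ c : Polynomial ℝ, c.Monic → c.natDegree = n → aeval s c = 0 := by
      intro c hc hd
      obtain ⟨K, rfl⟩ := h c hc hd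
      have hA' : ((A + K * C).map Complex.ofRealHom) *ᵥ v = s • v := by
        have e : (A + K * C).map Complex.ofRealHom
          = A.map Complex.ofReal + K.map Complex.ofReal * C.map Complex.ofReal := by
          rw [Matrix.map_add _ (map_add _), Matrix.map_mul]; rfl
        rw [e, Matrix.add_mulVec, ← Matrix.mulVec_mulVec, hC, hA]
        simp
      have : ((A + K * C).map Complex.ofRealHom).charpoly.eval s = 0 := by
        rw [Matrix.eval_charpoly, ← Matrix.exists_mulVec_eq_zero_iff]
        refine ⟨v, hv, ?_⟩
        rw [Matrix.sub_mulVec, hA']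
        simp [Matrix.scalar_apply, ← Matrix.smul_one_eq_diagonal, Matrix.smul_mulVec]
      rw [Matrix.charpoly_map, eval_map] at this
      exact this
    have h0 := key (X ^ n) (monic_X_pow n) (natDegree_X_pow n)
    have h1 := key ((X - Polynomial.C 1) ^ n) ((monic_X_sub_C 1).pow n) (by
      rw [(monic_X_sub_C (1 : ℝ)).natDegree_pow, natDegree_X_sub_C, mul_one])
    rw [map_pow, aeval_X] at h0
    rw [map_pow, map_sub, aeval_X, aeval_C, map_one] at h1
    have h2 := eq_zero_of_pow_eq_zero h0
    have h3 := eq_zero_of_pow_eq_zero h1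
    rw [h2] at h3
    norm_num at h3
end

section
/- Let A₂₂ be a real m×m matrix, A₁₂ a real p×m matrix, G a real k×p matrix, K a real m×p matrix, X a real m×k matrix, and Φ a real k×k matrix, and suppose G·A₁₂·X = −Φ. Define L = X·G − K and F = −(A₂₂ − L·A₁₂)·X − X·G·A₁₂·X, and let M be the (m+k)×(m+k) block matrix [[I_m, X], [0, I_k]]. Then M is invertible with inverse [[I_m, −X], [0, I_k]], and M⁻¹ · [[A₂₂ − L·A₁₂, F], [−G·A₁₂, 0]] · M = [[A₂₂ + K·A₁₂, 0], [−G·A₁₂, Φ]]. -/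
/-- Similarity identity (54)–(57) in the sufficiency proof of Theorem 2.
With `L = X·G − K`, `F = −(A₂₂ − L·A₁₂)·X − X·G·A₁₂·X` and `G·A₁₂·X = −Φ`, the
matrix `M = [[I, X], [0, I]]` is invertible with inverse `N = [[I, −X], [0, I]]`,
and conjugating `[[A₂₂ − L·A₁₂, F], [−G·A₁₂, 0]]` by `M` gives
`[[A₂₂ + K·A₁₂, 0], [−G·A₁₂, Φ]]`. -/
theorem observer_similarity_identity {m p k : ℕ}
    (A₂₂ : Matrix (Fin m) (Fin m) ℝ) (A₁₂ : Matrix (Fin p) (Fin m) ℝ)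
    (G : Matrix (Fin k) (Fin p) ℝ) (K : Matrix (Fin m) (Fin p) ℝ)
    (X : Matrix (Fin m) (Fin k) ℝ) (Φ : Matrix (Fin k) (Fin k) ℝ)
    (hGAX : G * A₁₂ * X = -Φ)
    (L : Matrix (Fin m) (Fin p) ℝ) (hL : L = X * G - K)
    (F : Matrix (Fin m) (Fin k) ℝ)
    (hF : F = -((A₂₂ - L * A₁₂) * X) - X * G * A₁₂ * X)
    (M N : Matrix (Fin m ⊕ Fin k) (Fin m ⊕ Fin k) ℝ)
    (hM : M = Matrix.fromBlocks (1 : Matrix (Fin m) (Fin m) ℝ) X 0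
      (1 : Matrix (Fin k) (Fin k) ℝ))
    (hN : N = Matrix.fromBlocks (1 : Matrix (Fin m) (Fin m) ℝ) (-X) 0
      (1 : Matrix (Fin k) (Fin k) ℝ)) :
    M * N = 1 ∧ N * M = 1 ∧
      N * Matrix.fromBlocks (A₂₂ - L * A₁₂) F (-(G * A₁₂)) 0 * M =
        Matrix.fromBlocks (A₂₂ + K * A₁₂) 0 (-(G * A₁₂)) Φ := by
  have h1 : A₂₂ - L * A₁₂ + X * (G * A₁₂) = A₂₂ + K * A₁₂ := by
    rw [hL, Matrix.sub_mul, Matrix.mul_assoc]; abel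
  have h2 : (A₂₂ - L * A₁₂ + X * (G * A₁₂)) * X + F = 0 := by
    rw [hF, Matrix.add_mul, Matrix.mul_assoc X G A₁₂]; abel
  rw [h1] at h2
  subst hM hN
  refine ⟨?_, ?_, ?_⟩
  · simp [Matrix.fromBlocks_multiply]
  · simp [Matrix.fromBlocks_multiply]
  · rw [Matrix.fromBlocks_multiply, Matrix.fromBlocks_multiply]
    simp only [Matrix.one_mul, Matrix.mul_one, Matrix.zero_mul, Matrix.mul_zero, add_zero,
      zero_add, Matrix.neg_mul, Matrix.mul_neg, neg_neg, h1, h2, hGAX]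
end
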